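/- The coassociative 4-form ψ₀ is a calibration on ℝ⁷: for all vectors x, y, z, w in ℝ⁷, ψ₀(x,y,z,w)² ≤ |x∧y∧z∧w|²; in particular |ψ₀(x,y,z,w)| ≤ 1 whenever x, y, z, w are orthonormal. -/

import Mathlib

noncomputable section
open scoped RealInnerProductSpace

abbrev E7 := EuclideanSpace ℝ (Fin 7)

/-- `dxⁱ ∧ dxʲ ∧ dxᵏ` evaluated on `(x, y, z)` (indices 0-based). -/
def d3 (i j k : Fin 7) (x y z : E7) : ℝ :=
  Matrix.det !![x i, x j, x k; y i, y j, y k; z i, z j, z k]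

/-- `dxⁱ ∧ dxʲ ∧ dxᵏ ∧ dxˡ` evaluated on `(x, y, z, w)` (indices 0-based). -/
def d4 (i j k l : Fin 7) (x y z w : E7) : ℝ :=
  Matrix.det !![x i, x j, x k, x l; y i, y j, y k, y l;
                z i, z j, z k, z l; w i, w j, w k, w l]

/-- The associative 3-form
`φ₀ = dx¹²³ + dx¹⁴⁵ − dx¹⁶⁷ + dx²⁴⁶ + dx²⁵⁷ + dx³⁴⁷ − dx³⁵⁶` (1-based indices; here 0-based). -/
def phi (x y z : E7) : ℝ :=
  d3 0 1 2 x y z + d3 0 3 4 x y z - d3 0 5 6 x y z + d3 1 3 5 x y z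
    + d3 1 4 6 x y z + d3 2 3 6 x y z - d3 2 4 5 x y z

/-- The coassociative 4-form
`ψ₀ = dx⁴⁵⁶⁷ + dx²³⁶⁷ − dx²³⁴⁵ + dx¹³⁵⁷ + dx¹³⁴⁶ + dx¹²⁵⁶ − dx¹²⁴⁷` (1-based; here 0-based). -/
def psi (x y z w : E7) : ℝ :=
  d4 3 4 5 6 x y z w + d4 1 2 5 6 x y z w - d4 1 2 3 4 x y z w + d4 0 2 4 6 x y z w
    + d4 0 2 3 5 x y z w + d4 0 1 4 5 x y z w - d4 0 1 3 6 x y z w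

/-- The Gram determinant `|x∧y∧z∧w|² = det(⟨vᵢ,vⱼ⟩)`. -/
def gram4 (x y z w : E7) : ℝ :=
  Matrix.det !![⟪x, x⟫, ⟪x, y⟫, ⟪x, z⟫, ⟪x, w⟫;
                ⟪y, x⟫, ⟪y, y⟫, ⟪y, z⟫, ⟪y, w⟫;
                ⟪z, x⟫, ⟪z, y⟫, ⟪z, z⟫, ⟪z, w⟫;
                ⟪w, x⟫, ⟪w, y⟫, ⟪w, z⟫, ⟪w, w⟫]

lemma d3_expand (i j k : Fin 7) (x y z : E7) : d3 i j k x y z =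
    x i * (y j * z k - y k * z j) - x j * (y i * z k - y k * z i)
      + x k * (y i * z j - y j * z i) := by
  simp [d3, Matrix.det_fin_three]; ring

lemma d4_expand (i j k l : Fin 7) (x y z w : E7) : d4 i j k l x y z w =
    w l * d3 i j k x y z - w k * d3 i j l x y z + w j * d3 i k l x y z
      - w i * d3 j k l x y z := by
  simp only [d3_expand]
  simp [d4, Matrix.det_succ_row_zero, Fin.sum_univ_succ, Fin.succAbove]
  ring

/-- The vector with `⟪chi x y z, w⟫ = psi x y z w`. -/
def chi (x y z : E7) : E7 :=
  !₂[- d3 2 4 6 x y z - d3 2 3 5 x y z - d3 1 4 5 x y z + d3 1 3 6 x y z,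
     - d3 2 5 6 x y z + d3 2 3 4 x y z + d3 0 4 5 x y z - d3 0 3 6 x y z,
     d3 1 5 6 x y z - d3 1 3 4 x y z + d3 0 4 6 x y z + d3 0 3 5 x y z,
     - d3 4 5 6 x y z + d3 1 2 4 x y z - d3 0 2 5 x y z + d3 0 1 6 x y z,
     d3 3 5 6 x y z - d3 1 2 3 x y z - d3 0 2 6 x y z - d3 0 1 5 x y z,
     - d3 3 4 6 x y z - d3 1 2 6 x y z + d3 0 2 3 x y z + d3 0 1 4 x y z,
     d3 3 4 5 x y z + d3 1 2 5 x y z + d3 0 2 4 x y z - d3 0 1 3 x y z]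

lemma inner_coord (x y : E7) : ⟪x, y⟫ = x 0 * y 0 + x 1 * y 1 + x 2 * y 2 + x 3 * y 3
    + x 4 * y 4 + x 5 * y 5 + x 6 * y 6 := by
  simp [PiLp.inner_apply, Fin.sum_univ_succ]
  ring_nf

lemma chi_inner (x y z w : E7) : ⟪chi x y z, w⟫ = psi x y z w := by
  rw [inner_coord, psi]
  simp only [d4_expand]
  simp [chi]
  ring

def gram3 (x y z : E7) : ℝ :=
  ⟪x, x⟫ * (⟪y, y⟫ * ⟪z, z⟫ - ⟪y, z⟫ ^ 2) - ⟪x, y⟫ * (⟪x, y⟫ * ⟪z, z⟫ - ⟪y, z⟫ * ⟪x, z⟫)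
    + ⟪x, z⟫ * (⟪x, y⟫ * ⟪y, z⟫ - ⟪y, y⟫ * ⟪x, z⟫)

lemma chi_x (x y z : E7) : ⟪chi x y z, x⟫ = 0 := by
  rw [chi_inner, psi]; simp only [d4_expand, d3_expand]; ring
lemma chi_y (x y z : E7) : ⟪chi x y z, y⟫ = 0 := by
  rw [chi_inner, psi]; simp only [d4_expand, d3_expand]; ring
lemma chi_z (x y z : E7) : ⟪chi x y z, z⟫ = 0 := by
  rw [chi_inner, psi]; simp only [d4_expand, d3_expand]; ring

set_option maxHeartbeats 4000000 in
lemma chi_norm (x y z : E7) : ⟪chi x y z, chi x y z⟫ + phi x y z ^ 2 = gram3 x y z := by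
  simp only [gram3, inner_coord, phi]
  simp [chi]
  simp only [d3_expand]
  ring

lemma gram4_expand (x y z w : E7) : gram4 x y z w =
    ⟪w, w⟫ * gram3 x y z
    - ⟪x, w⟫ * (⟪x, w⟫ * (⟪y, y⟫ * ⟪z, z⟫ - ⟪y, z⟫ ^ 2)
        - ⟪y, w⟫ * (⟪x, y⟫ * ⟪z, z⟫ - ⟪y, z⟫ * ⟪x, z⟫)
        + ⟪z, w⟫ * (⟪x, y⟫ * ⟪y, z⟫ - ⟪y, y⟫ * ⟪x, z⟫))
    - ⟪y, w⟫ * (- ⟪x, w⟫ * (⟪x, y⟫ * ⟪z, z⟫ - ⟪y, z⟫ * ⟪x, z⟫)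
        + ⟪y, w⟫ * (⟪x, x⟫ * ⟪z, z⟫ - ⟪x, z⟫ ^ 2)
        - ⟪z, w⟫ * (⟪x, x⟫ * ⟪y, z⟫ - ⟪x, y⟫ * ⟪x, z⟫))
    - ⟪z, w⟫ * (⟪x, w⟫ * (⟪x, y⟫ * ⟪y, z⟫ - ⟪y, y⟫ * ⟪x, z⟫)
        - ⟪y, w⟫ * (⟪x, x⟫ * ⟪y, z⟫ - ⟪x, y⟫ * ⟪x, z⟫)
        + ⟪z, w⟫ * (⟪x, x⟫ * ⟪y, y⟫ - ⟪x, y⟫ ^ 2)) := by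
  rw [gram4, real_inner_comm x y, real_inner_comm x z, real_inner_comm x w,
    real_inner_comm y z, real_inner_comm y w, real_inner_comm z w, gram3]
  generalize ⟪x, x⟫ = a, ⟪y, x⟫ = b, ⟪z, x⟫ = c, ⟪w, x⟫ = d, ⟪y, y⟫ = e, ⟪z, y⟫ = f,
    ⟪w, y⟫ = g, ⟪z, z⟫ = h, ⟪w, z⟫ = i, ⟪w, w⟫ = j
  simp [Matrix.det_succ_row_zero, Fin.sum_univ_succ, Fin.succAbove]
  ring

lemma gram4_nonneg (x y z w : E7) : 0 ≤ gram4 x y z w := by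
  have h := (Matrix.posSemidef_gram ℝ ![x, y, z, w]).det_nonneg
  suffices e : gram4 x y z w = (Matrix.gram ℝ ![x, y, z, w]).det by rw [e]; exact h
  rw [gram4]
  congr 1
  ext i j
  fin_cases i <;> fin_cases j <;> rfl

lemma perp_exists (x y z w : E7) : ∃ u : E7,
    ⟪chi x y z, u⟫ = gram3 x y z * psi x y z w ∧ ⟪u, u⟫ = gram3 x y z * gram4 x y z w := by
  refine ⟨gram3 x y z • w
    - (⟪x, w⟫ * (⟪y, y⟫ * ⟪z, z⟫ - ⟪y, z⟫ ^ 2)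
        - ⟪y, w⟫ * (⟪x, y⟫ * ⟪z, z⟫ - ⟪y, z⟫ * ⟪x, z⟫)
        + ⟪z, w⟫ * (⟪x, y⟫ * ⟪y, z⟫ - ⟪y, y⟫ * ⟪x, z⟫)) • x
    - (- ⟪x, w⟫ * (⟪x, y⟫ * ⟪z, z⟫ - ⟪y, z⟫ * ⟪x, z⟫)
        + ⟪y, w⟫ * (⟪x, x⟫ * ⟪z, z⟫ - ⟪x, z⟫ ^ 2)
        - ⟪z, w⟫ * (⟪x, x⟫ * ⟪y, z⟫ - ⟪x, y⟫ * ⟪x, z⟫)) • y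
    - (⟪x, w⟫ * (⟪x, y⟫ * ⟪y, z⟫ - ⟪y, y⟫ * ⟪x, z⟫)
        - ⟪y, w⟫ * (⟪x, x⟫ * ⟪y, z⟫ - ⟪x, y⟫ * ⟪x, z⟫)
        + ⟪z, w⟫ * (⟪x, x⟫ * ⟪y, y⟫ - ⟪x, y⟫ ^ 2)) • z, ?_, ?_⟩
  · simp only [inner_sub_right, inner_smul_right, chi_x, chi_y, chi_z, chi_inner]
    ring
  · rw [gram4_expand]
    simp only [inner_sub_right, inner_smul_right, inner_sub_left, real_inner_smul_left, gram3]
    rw [real_inner_comm x y, real_inner_comm x z, real_inner_comm x w,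
      real_inner_comm y z, real_inner_comm y w, real_inner_comm z w]
    ring

lemma calib (x y z w : E7) : psi x y z w ^ 2 ≤ gram4 x y z w := by
  have hn := chi_norm x y z
  have hc : 0 ≤ ⟪chi x y z, chi x y z⟫ := real_inner_self_nonneg
  have hG : ⟪chi x y z, chi x y z⟫ ≤ gram3 x y z := by nlinarith [sq_nonneg (phi x y z)]
  have h4 := gram4_nonneg x y z w
  rcases (hc.trans hG).eq_or_lt with h0 | hpos
  · have : chi x y z = 0 := inner_self_eq_zero.mp (le_antisymm (h0 ▸ hG) hc)
    rw [← chi_inner, this, inner_zero_left]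
    simpa using h4
  · obtain ⟨u, h1, h2⟩ := perp_exists x y z w
    have cs := real_inner_mul_inner_self_le (chi x y z) u
    rw [h1, h2] at cs
    have h5 := mul_le_mul_of_nonneg_right hG (mul_nonneg hpos.le h4)
    have h6 : (gram3 x y z) ^ 2 * psi x y z w ^ 2 ≤ (gram3 x y z) ^ 2 * gram4 x y z w := by
      nlinarith
    exact le_of_mul_le_mul_left h6 (by positivity)

/-- the coassociative 4-form is a calibration on ℝ⁷:
`ψ₀(x,y,z,w)² ≤ |x∧y∧z∧w|²` for all `x,y,z,w`, and `|ψ₀| ≤ 1` on orthonormal quadruples. -/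
theorem coassociative_is_calibration :
    (∀ x y z w : E7, psi x y z w ^ 2 ≤ gram4 x y z w) ∧
    (∀ x y z w : E7, Orthonormal ℝ ![x, y, z, w] → |psi x y z w| ≤ 1) := by
  refine ⟨calib, fun x y z w h => ?_⟩
  have hg : gram4 x y z w = 1 := by
    have h2 := orthonormal_iff_ite.mp h
    rw [gram4, ← Matrix.det_one (n := Fin 4)]
    congr 1
    ext i j
    rw [Matrix.one_apply, ← h2 i j]
    fin_cases i <;> fin_cases j <;> rfl
  rw [← sq_le_one_iff_abs_le_one]
  exact hg ▸ calib x y z w
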